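/- Let A be a commutative ring and φ : A((t)) → A((t)) a continuous A-algebra endomorphism with φ(t) = g where g ∈ A((t)) is a unit of the form g = t·u·(1+g₊)·(1+g₋) with u ∈ A*, g₊ ∈ tA[[t]], and g₋ nilpotent supported in negative degrees (so that ν(g) = 1). Then φ is an automorphism, and its inverse satisfies, for all f ∈ A((t)): the coefficient of t^l in φ^{-1}(f) equals res(f · g^{−l−1} · g' dt), where g' = dg/dt and res takes the coefficient of t^{-1}. -/

import Mathlib

/-- The formal derivative `d/dt` of a Laurent series. -/
noncomputable def lderiv {A : Type*} [CommRing A] (f : LaurentSeries A) : LaurentSeries A where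
  coeff l := (l + 1) • f.coeff (l + 1)
  isPWO_support' := by
    refine Set.IsPWO.mono ((f.isPWO_support.image_of_monotone
      (f := fun l : ℤ => l - 1) (fun a b h => by simpa using h))) ?_
    intro l hl
    have h1 : f.coeff (l + 1) ≠ 0 := by
      intro h; simp [Function.mem_support, h] at hl
    exact ⟨l + 1, h1, by ring⟩

/-- A sequence of Laurent series tends to `0` in the `t`-adic (Laurent series) topology. -/
def LSTendsToZero {A : Type*} [CommRing A] (s : ℕ → LaurentSeries A) : Prop :=
  ∀ N : ℤ, ∃ I : ℕ, ∀ i ≥ I, ∀ l < N, (s i).coeff l = 0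

section Derivative

variable {A : Type*} [CommRing A]

theorem lderiv_coeff (f : LaurentSeries A) (l : ℤ) :
    (lderiv f).coeff l = (l + 1) • f.coeff (l + 1) := rfl

/-- The Euler operator `t d/dt` on Laurent series. -/
noncomputable def eulerOp (f : LaurentSeries A) : LaurentSeries A where
  coeff l := l • f.coeff l
  isPWO_support' := f.isPWO_support.mono fun l hl h => hl (by simp [h])

theorem eulerOp_coeff (f : LaurentSeries A) (l : ℤ) : (eulerOp f).coeff l = l • f.coeff l := rfl

theorem support_eulerOp_subset (f : LaurentSeries A) : (eulerOp f).support ⊆ f.support :=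
  fun l hl h => hl (by simp [eulerOp_coeff, h])

theorem eulerOp_mul (f g : LaurentSeries A) :
    eulerOp (f * g) = eulerOp f * g + f * eulerOp g := by
  ext l
  rw [HahnSeries.coeff_add, eulerOp_coeff,
    HahnSeries.coeff_mul_left' f.isPWO_support (support_eulerOp_subset f),
    HahnSeries.coeff_mul_right' g.isPWO_support (support_eulerOp_subset g),
    HahnSeries.coeff_mul, Finset.smul_sum, ← Finset.sum_add_distrib]
  refine Finset.sum_congr rfl fun ij hij => ?_
  have h : ij.1 + ij.2 = l := (Finset.mem_antidiagonal.mp hij).2.2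
  rw [← h, eulerOp_coeff, eulerOp_coeff, add_smul, smul_mul_assoc, mul_smul_comm]

theorem lderiv_eq_single_mul_eulerOp (f : LaurentSeries A) :
    lderiv f = HahnSeries.single (-1 : ℤ) (1 : A) * eulerOp f := by
  ext l
  rw [HahnSeries.coeff_single_mul, eulerOp_coeff, lderiv_coeff, one_mul, sub_neg_eq_add]

theorem lderiv_mul (f g : LaurentSeries A) : lderiv (f * g) = lderiv f * g + f * lderiv g := by
  simp only [lderiv_eq_single_mul_eulerOp, eulerOp_mul]
  ring

theorem lderiv_one : lderiv (1 : LaurentSeries A) = 0 := by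
  have h := lderiv_mul (1 : LaurentSeries A) 1
  simpa using h

theorem lderiv_one_add (f : LaurentSeries A) : lderiv (1 + f) = lderiv f := by
  have h : lderiv (1 + f) = lderiv 1 + lderiv f := by
    ext l
    simp [lderiv_coeff]
  rw [h, lderiv_one, zero_add]

theorem lderiv_C (c : A) : lderiv (HahnSeries.C c : LaurentSeries A) = 0 := by
  ext l
  by_cases h : l + 1 = 0 <;> simp [lderiv_coeff, HahnSeries.C_apply, h]

theorem lderiv_single_one : lderiv (HahnSeries.single (1 : ℤ) (1 : A)) = 1 := by
  ext l
  by_cases h : l = 0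
  · simp [lderiv_coeff, h]
  · have h' : l + 1 ≠ 1 := by omega
    simp [lderiv_coeff, h, HahnSeries.coeff_one]

theorem lderiv_pow_succ (f : LaurentSeries A) (n : ℕ) :
    lderiv (f ^ (n + 1)) = (n + 1) • (f ^ n * lderiv f) := by
  induction n with
  | zero => simp
  | succ n ih =>
    rw [pow_succ, lderiv_mul, ih]
    simp only [nsmul_eq_mul]
    push_cast
    ring

theorem coeff_lderiv_neg_one (f : LaurentSeries A) : (lderiv f).coeff (-1) = 0 := by
  simp [lderiv_coeff]

/-- The residue of `hⁿ dh` vanishes for `n : ℕ`, over an arbitrary commutative ring. -/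
theorem coeff_pow_mul_lderiv (h : LaurentSeries A) (n : ℕ) :
    (h ^ n * lderiv h).coeff (-1) = 0 := by
  classical
  let π : MvPolynomial A ℤ →+* A := MvPolynomial.eval₂Hom (Int.castRingHom A) id
  let lift : LaurentSeries (MvPolynomial A ℤ) :=
    { coeff := fun l => if h.coeff l = 0 then 0 else MvPolynomial.X (h.coeff l)
      isPWO_support' := h.isPWO_support.mono fun l hl h0 => hl (by simp [h0]) }
  have hlift : lift.map π = h := by
    ext l
    by_cases h0 : h.coeff l = 0 <;> simp [lift, π, h0]
  have hres : (lift ^ n * lderiv lift).coeff (-1) = 0 := by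
    have h1 := coeff_lderiv_neg_one (lift ^ (n + 1))
    rw [lderiv_pow_succ, HahnSeries.coeff_smul] at h1
    exact (smul_eq_zero.mp h1).resolve_left (Nat.succ_ne_zero n)
  have hmap_mul : ∀ x y : LaurentSeries (MvPolynomial A ℤ),
      (x * y).map π = x.map π * y.map π :=
    fun x y => HahnSeries.map_mul (π : MvPolynomial A ℤ →ₙ+* A)
  have hmap_pow : ∀ k : ℕ, (lift ^ k).map π = h ^ k := by
    intro k
    induction k with
    | zero =>
      rw [pow_zero, pow_zero]
      exact HahnSeries.map_one π.toMonoidWithZeroHom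
    | succ k ih => rw [pow_succ, pow_succ, hmap_mul, ih, hlift]
  have hmap_deriv : (lderiv lift).map π = lderiv h := by
    ext l
    rw [HahnSeries.map_coeff, lderiv_coeff, lderiv_coeff, map_zsmul, ← HahnSeries.map_coeff, hlift]
  rw [← hmap_pow, ← hmap_deriv, ← hmap_mul, HahnSeries.map_coeff, hres, map_zero]

/-- The residue of `gⁿ dg` vanishes for every integer `n ≠ -1`. -/
theorem coeff_zpow_mul_lderiv (G : (LaurentSeries A)ˣ) {n : ℤ} (hn : n ≠ -1) :
    (((G ^ n : (LaurentSeries A)ˣ) : LaurentSeries A) * lderiv (G : LaurentSeries A)).coeff (-1)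
      = 0 := by
  obtain ⟨k, rfl⟩ | ⟨k, rfl⟩ : (∃ k : ℕ, n = k) ∨ ∃ k : ℕ, n = -(k : ℤ) - 2 := by
    rcases le_or_gt 0 n with h | h
    · exact Or.inl ⟨n.toNat, by omega⟩
    · exact Or.inr ⟨(-n - 2).toNat, by omega⟩
  · rw [zpow_natCast, Units.val_pow_eq_pow_val]
    exact coeff_pow_mul_lderiv _ k
  · set H : LaurentSeries A := ((G⁻¹ : (LaurentSeries A)ˣ) : LaurentSeries A) with hH
    have hGH : (G : LaurentSeries A) * H = 1 := G.mul_inv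
    have hz : ((G ^ (-(k : ℤ) - 2) : (LaurentSeries A)ˣ) : LaurentSeries A) = H ^ (k + 2) := by
      rw [hH, ← Units.val_pow_eq_pow_val, inv_pow, ← zpow_natCast, ← zpow_neg]
      congr 2
      push_cast
      ring
    have hd : lderiv (G : LaurentSeries A) * H + G * lderiv H = 0 := by
      rw [← lderiv_mul, hGH, lderiv_one]
    have : H ^ (k + 2) * lderiv (G : LaurentSeries A) = -(H ^ k * lderiv H) := by
      linear_combination H ^ (k + 1) * hd - H ^ k * lderiv H * hGH
    rw [hz, this, HahnSeries.coeff_neg, coeff_pow_mul_lderiv, neg_zero]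

theorem inv_mul_lderiv_mul (v w : (LaurentSeries A)ˣ) :
    (((v * w)⁻¹ : (LaurentSeries A)ˣ) : LaurentSeries A) * lderiv ((v : LaurentSeries A) * (w : LaurentSeries A)) =
      ((v⁻¹ : (LaurentSeries A)ˣ) : LaurentSeries A) * lderiv (v : LaurentSeries A) +
      ((w⁻¹ : (LaurentSeries A)ˣ) : LaurentSeries A) * lderiv (w : LaurentSeries A) := by
  rw [lderiv_mul, mul_inv, Units.val_mul]
  linear_combination
    ((v⁻¹ : (LaurentSeries A)ˣ) : LaurentSeries A) * lderiv (v : LaurentSeries A) * w.inv_mul +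
    ((w⁻¹ : (LaurentSeries A)ˣ) : LaurentSeries A) * lderiv (w : LaurentSeries A) * v.inv_mul

/-- The residue of the logarithmic derivative of `1 + f`, `f` nilpotent, vanishes. -/
theorem coeff_inv_mul_lderiv_one_add (f : LaurentSeries A) (hf : IsNilpotent f)
    (v : (LaurentSeries A)ˣ) (hv : (v : LaurentSeries A) = 1 + f) :
    (((v⁻¹ : (LaurentSeries A)ˣ) : LaurentSeries A) * lderiv (v : LaurentSeries A)).coeff (-1)
      = 0 := by
  obtain ⟨n, hn⟩ := hf
  have hinv : ((v⁻¹ : (LaurentSeries A)ˣ) : LaurentSeries A) =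
      ∑ k ∈ Finset.range n, (-f) ^ k := by
    have hgeom := mul_neg_geom_sum (-f) n
    rw [sub_neg_eq_add, neg_pow, hn, mul_zero, sub_zero, ← hv] at hgeom
    exact Units.inv_eq_of_mul_eq_one_right hgeom
  rw [hinv, hv, lderiv_one_add, Finset.sum_mul, HahnSeries.coeff_sum]
  refine Finset.sum_eq_zero fun k _ => ?_
  have hs : (-f) ^ k * lderiv f = (-1 : ℤ) ^ k • (f ^ k * lderiv f) := by
    rw [neg_pow, zsmul_eq_mul]
    push_cast
    ring
  rw [hs, HahnSeries.coeff_smul, coeff_pow_mul_lderiv, smul_zero]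

end Derivative

section Filtration

variable {A : Type*} [CommRing A]

/-- The additive subgroup `t^N A[[t]]` of `A((t))`. -/
def orderGE (A : Type*) [CommRing A] (N : ℤ) : AddSubgroup (LaurentSeries A) where
  carrier := {f | ∀ l < N, f.coeff l = 0}
  zero_mem' := fun l _ => HahnSeries.coeff_zero
  add_mem' := fun hf hg l hl => by rw [HahnSeries.coeff_add, hf l hl, hg l hl, add_zero]
  neg_mem' := fun hf l hl => by rw [HahnSeries.coeff_neg, hf l hl, neg_zero]

theorem mem_orderGE {N : ℤ} {f : LaurentSeries A} :
    f ∈ orderGE A N ↔ ∀ l < N, f.coeff l = 0 := Iff.rfl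

theorem orderGE_anti {M N : ℤ} (h : M ≤ N) : orderGE A N ≤ orderGE A M :=
  fun _ hf l hl => hf l (hl.trans_le h)

theorem exists_mem_orderGE (f : LaurentSeries A) : ∃ N, f ∈ orderGE A N :=
  ⟨f.order, fun _ hl => HahnSeries.coeff_eq_zero_of_lt_order hl⟩

theorem mul_mem_orderGE {M N : ℤ} {f g : LaurentSeries A} (hf : f ∈ orderGE A M)
    (hg : g ∈ orderGE A N) : f * g ∈ orderGE A (M + N) := by
  intro l hl
  rw [HahnSeries.coeff_mul]
  refine Finset.sum_eq_zero fun ij hij => ?_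
  have h : ij.1 + ij.2 = l := (Finset.mem_antidiagonal.mp hij).2.2
  rcases lt_or_ge ij.1 M with h1 | h1
  · rw [hf _ h1, zero_mul]
  · rw [hg _ (by omega), mul_zero]

theorem single_mem_orderGE (n : ℤ) (c : A) : HahnSeries.single n c ∈ orderGE A n :=
  fun _ hl => HahnSeries.coeff_single_of_ne hl.ne

theorem C_mem_orderGE (c : A) : (HahnSeries.C c : LaurentSeries A) ∈ orderGE A 0 :=
  single_mem_orderGE 0 c

theorem ofPowerSeries_mem_orderGE (p : PowerSeries A) :
    HahnSeries.ofPowerSeries ℤ A p ∈ orderGE A 0 := by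
  intro l hl
  have h := PowerSeries.coeff_coe p l
  rwa [if_pos hl] at h

theorem lderiv_mem_orderGE {f : LaurentSeries A} (hf : f ∈ orderGE A 0) :
    lderiv f ∈ orderGE A 0 := by
  intro l hl
  rcases eq_or_ne (l + 1) 0 with h | h
  · rw [lderiv_coeff, h, zero_smul]
  · rw [lderiv_coeff, hf _ (by omega), smul_zero]

/-- An additive subgroup stable under constants, containing some `t^N A[[t]]` and a series with
leading term a unit multiple of `t^j` for every `j`, is everything. -/
theorem mem_of_orderGE_le (P : AddSubgroup (LaurentSeries A))
    (hC : ∀ (c : A), ∀ x ∈ P, HahnSeries.C c * x ∈ P) {N : ℤ} (hN : orderGE A N ≤ P)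
    (p : ℤ → LaurentSeries A) (hp : ∀ j, p j ∈ P) (hpo : ∀ j, p j ∈ orderGE A j)
    (hpu : ∀ j, IsUnit ((p j).coeff j)) (x : LaurentSeries A) : x ∈ P := by
  have key : ∀ k : ℕ, ∀ x ∈ orderGE A (N - k), x ∈ P := by
    intro k
    induction k with
    | zero => exact fun x hx => hN (by simpa using hx)
    | succ k ih =>
      intro x hx
      set j : ℤ := N - ((k + 1 : ℕ) : ℤ) with hj
      obtain ⟨v, hv⟩ := hpu j
      set y : LaurentSeries A := HahnSeries.C (x.coeff j * (v⁻¹ : Aˣ)) * p j with hy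
      have hyP : y ∈ P := hC _ _ (hp j)
      have hsub : x - y ∈ orderGE A (N - k) := by
        intro l hl
        rcases eq_or_ne l j with rfl | h
        · rw [HahnSeries.coeff_sub, hy, HahnSeries.C_mul_eq_smul, HahnSeries.coeff_smul, ← hv,
            smul_eq_mul, mul_assoc, Units.inv_mul, mul_one, sub_self]
        · have hlj : l < j := by omega
          rw [HahnSeries.coeff_sub, hx l hlj, hy, HahnSeries.C_mul_eq_smul,
            HahnSeries.coeff_smul, hpo j l hlj, smul_zero, sub_zero]
      have := P.add_mem (ih _ hsub) hyP
      rwa [sub_add_cancel] at this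
  obtain ⟨M, hM⟩ := exists_mem_orderGE x
  exact key (N - M).toNat x (orderGE_anti (by omega) hM)

end Filtration

section Nilpotent

variable {A : Type*} [CommRing A]

theorem isNilpotent_coeff {f : LaurentSeries A} (hf : IsNilpotent f) (l : ℤ) :
    IsNilpotent (f.coeff l) := by
  obtain ⟨n, hn⟩ := hf
  rw [← mem_nilradical, nilradical_eq_sInf, Ideal.mem_sInf]
  intro p hp
  have : p.IsPrime := hp
  let π := Ideal.Quotient.mk p
  have hpow : ∀ k : ℕ, (f ^ k).map π = (f.map π : LaurentSeries (A ⧸ p)) ^ k := by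
    intro k
    induction k with
    | zero =>
      rw [pow_zero, pow_zero]
      exact HahnSeries.map_one π.toMonoidWithZeroHom
    | succ k ih =>
      rw [pow_succ, pow_succ, ← ih]
      exact HahnSeries.map_mul (π : A →ₙ+* A ⧸ p)
  have h0 : (f.map π : LaurentSeries (A ⧸ p)) ^ n = 0 := by
    rw [← hpow, hn]
    ext
    simp
  have h1 : (f.map π : LaurentSeries (A ⧸ p)) = 0 := eq_zero_of_pow_eq_zero h0
  have h2 : π (f.coeff l) = 0 := by
    rw [← HahnSeries.map_coeff, h1, HahnSeries.coeff_zero]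
  exact Ideal.Quotient.eq_zero_iff_mem.mp h2

/-- A nilpotent Laurent series supported in negative degrees lies in the extension of a nilpotent
ideal of coefficients. -/
theorem exists_isNilpotent_ideal {f : LaurentSeries A} (hf : IsNilpotent f)
    (hneg : ∀ l : ℤ, 0 ≤ l → f.coeff l = 0) :
    ∃ I : Ideal A, IsNilpotent I ∧
      f ∈ I.map (HahnSeries.C : A →+* LaurentSeries A) := by
  obtain ⟨N, hN⟩ := exists_mem_orderGE f
  refine ⟨Ideal.span (f.coeff '' Set.Ico N 0), ?_, ?_⟩
  · rw [Ideal.FG.isNilpotent_iff_le_nilradical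
      (Submodule.fg_span ((Set.finite_Ico N 0).image f.coeff)), Ideal.span_le]
    rintro _ ⟨l, -, rfl⟩
    exact isNilpotent_coeff hf l
  · have hsum : f = ∑ l ∈ Finset.Ico N 0,
        HahnSeries.C (f.coeff l) * HahnSeries.single l (1 : A) := by
      ext l
      simp only [HahnSeries.coeff_sum, HahnSeries.C_mul_eq_smul, HahnSeries.coeff_smul,
        HahnSeries.coeff_single, smul_eq_mul, mul_ite, mul_one, mul_zero]
      rw [Finset.sum_ite_eq]
      split_ifs with h
      · rfl
      · rw [Finset.mem_Ico, not_and_or, not_le, not_lt] at h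
        exact h.elim (hN l) (hneg l)
    refine Eq.subst (motive := fun z => z ∈ _) hsum.symm ?_
    refine Ideal.sum_mem _ fun l hl => Ideal.mul_mem_right _ _ (Ideal.mem_map_of_mem _ ?_)
    exact Ideal.subset_span ⟨l, by simpa using hl, rfl⟩

/-- Nakayama's lemma for a nilpotent ideal of constants. -/
theorem mem_of_isNilpotent_of_forall_exists (U : AddSubgroup (LaurentSeries A))
    (hC : ∀ (c : A), ∀ x ∈ U, HahnSeries.C c * x ∈ U) {I : Ideal A} (hI : IsNilpotent I)
    (h : ∀ x, ∃ y ∈ U, x - y ∈ I.map (HahnSeries.C : A →+* LaurentSeries A))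
    (x : LaurentSeries A) : x ∈ U := by
  have key : ∀ n : ℕ, ∀ x, ∃ y ∈ U,
      x - y ∈ (I ^ n).map (HahnSeries.C : A →+* LaurentSeries A) := by
    intro n
    induction n with
    | zero => exact fun x => ⟨0, U.zero_mem, by simp [Ideal.one_eq_top, Ideal.map_top]⟩
    | succ n ih =>
      have step : ∀ z ∈ (I ^ n).map (HahnSeries.C : A →+* LaurentSeries A), ∃ y ∈ U,
          z - y ∈ (I ^ (n + 1)).map (HahnSeries.C : A →+* LaurentSeries A) := by
        intro z hz
        induction hz using Submodule.closure_induction with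
        | zero => exact ⟨0, U.zero_mem, by simp⟩
        | add a b _ _ ha hb =>
          obtain ⟨y, hy, hay⟩ := ha
          obtain ⟨y', hy', hby⟩ := hb
          exact ⟨y + y', U.add_mem hy hy', by
            rw [add_sub_add_comm]; exact Ideal.add_mem _ hay hby⟩
        | smul_mem w a ha =>
          obtain ⟨c, hc, rfl⟩ := ha
          obtain ⟨y, hy, hwy⟩ := h w
          refine ⟨HahnSeries.C c * y, hC c y hy, ?_⟩
          rw [smul_eq_mul, mul_comm w, ← mul_sub, pow_succ, Ideal.map_mul]
          exact Ideal.mul_mem_mul (Ideal.mem_map_of_mem _ hc) hwy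
      intro x
      obtain ⟨y, hy, hxy⟩ := ih x
      obtain ⟨y', hy', hxy'⟩ := step _ hxy
      exact ⟨y + y', U.add_mem hy hy', by rwa [← sub_sub]⟩
  obtain ⟨n, hn⟩ := hI
  obtain ⟨y, hy, hxy⟩ := key n x
  rw [hn, Submodule.zero_eq_bot, Ideal.map_bot, Ideal.mem_bot, sub_eq_zero] at hxy
  rwa [hxy]

end Nilpotent

section Units

variable {A : Type*} [CommRing A]

/-- The variable `t` as a unit of `A((t))`. -/
noncomputable def tUnit (A : Type*) [CommRing A] : (LaurentSeries A)ˣ where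
  val := HahnSeries.single (1 : ℤ) 1
  inv := HahnSeries.single (-1 : ℤ) 1
  val_inv := by simp [HahnSeries.single_mul_single]
  inv_val := by simp [HahnSeries.single_mul_single]

theorem tUnit_zpow (n : ℤ) :
    ((tUnit A ^ n : (LaurentSeries A)ˣ) : LaurentSeries A) = HahnSeries.single n 1 := by
  obtain ⟨k, rfl | rfl⟩ := n.eq_nat_or_neg
  · rw [zpow_natCast, Units.val_pow_eq_pow_val]
    change (HahnSeries.single (1 : ℤ) (1 : A)) ^ k = _
    rw [HahnSeries.single_pow]
    simp
  · rw [zpow_neg, ← inv_zpow, zpow_natCast, Units.val_pow_eq_pow_val]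
    change (HahnSeries.single (-1 : ℤ) (1 : A)) ^ k = _
    rw [HahnSeries.single_pow]
    simp

/-- The unit `t · u · w` of `A((t))` for a unit `u` of `A` and a unit `w` of `A[[t]]`. -/
noncomputable def tMulUnit (u : Aˣ) (w : (PowerSeries A)ˣ) : (LaurentSeries A)ˣ :=
  tUnit A * Units.map (HahnSeries.C : A →+* LaurentSeries A).toMonoidHom u *
    Units.map (HahnSeries.ofPowerSeries ℤ A).toMonoidHom w

theorem tMulUnit_zpow (u : Aˣ) (w : (PowerSeries A)ˣ) (n : ℤ) :
    ((tMulUnit u w ^ n : (LaurentSeries A)ˣ) : LaurentSeries A) =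
      HahnSeries.single n 1 * HahnSeries.C ((u ^ n : Aˣ) : A) *
        HahnSeries.ofPowerSeries ℤ A ((w ^ n : (PowerSeries A)ˣ) : PowerSeries A) := by
  rw [tMulUnit, mul_zpow, mul_zpow, ← map_zpow, ← map_zpow, Units.val_mul, Units.val_mul,
    tUnit_zpow]
  rfl

theorem tMulUnit_zpow_mem_orderGE (u : Aˣ) (w : (PowerSeries A)ˣ) (n : ℤ) :
    ((tMulUnit u w ^ n : (LaurentSeries A)ˣ) : LaurentSeries A) ∈ orderGE A n := by
  rw [tMulUnit_zpow]
  simpa using mul_mem_orderGE (mul_mem_orderGE (single_mem_orderGE n (1 : A))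
    (C_mem_orderGE ((u ^ n : Aˣ) : A))) (ofPowerSeries_mem_orderGE
      ((w ^ n : (PowerSeries A)ˣ) : PowerSeries A))

theorem isUnit_coeff_tMulUnit_zpow (u : Aˣ) (w : (PowerSeries A)ˣ) (n : ℤ) :
    IsUnit (((tMulUnit u w ^ n : (LaurentSeries A)ˣ) : LaurentSeries A).coeff n) := by
  have h := HahnSeries.ofPowerSeries_apply_coeff (Γ := ℤ)
    ((w ^ n : (PowerSeries A)ˣ) : PowerSeries A) 0
  rw [Nat.cast_zero] at h
  rw [tMulUnit_zpow, mul_assoc, HahnSeries.coeff_single_mul, sub_self, one_mul,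
    HahnSeries.C_mul_eq_smul, HahnSeries.coeff_smul, h, smul_eq_mul,
    PowerSeries.coeff_zero_eq_constantCoeff_apply]
  exact (u ^ n).isUnit.mul ((w ^ n).isUnit.map PowerSeries.constantCoeff)

/-- The residue of the logarithmic derivative of `t·u·w·(1 + f)`, `f` nilpotent, is `1`. -/
theorem coeff_inv_mul_lderiv (u : Aˣ) (w : (PowerSeries A)ˣ) (f : LaurentSeries A)
    (hf : IsNilpotent f) (v : (LaurentSeries A)ˣ) (hv : (v : LaurentSeries A) = 1 + f) :
    ((((tMulUnit u w * v)⁻¹ : (LaurentSeries A)ˣ) : LaurentSeries A) *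
      lderiv ((tMulUnit u w * v : (LaurentSeries A)ˣ) : LaurentSeries A)).coeff (-1) = 1 := by
  have hu : lderiv (Units.map (HahnSeries.C : A →+* LaurentSeries A).toMonoidHom u :
      LaurentSeries A) = 0 := lderiv_C _
  have ht : ((((tUnit A)⁻¹ : (LaurentSeries A)ˣ) : LaurentSeries A) *
      lderiv (tUnit A : LaurentSeries A)).coeff (-1) = 1 := by
    change (HahnSeries.single (-1 : ℤ) (1 : A) *
      lderiv (HahnSeries.single (1 : ℤ) (1 : A))).coeff (-1) = 1
    rw [lderiv_single_one, mul_one, HahnSeries.coeff_single_same]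
  have hw : (((Units.map (HahnSeries.ofPowerSeries ℤ A).toMonoidHom w)⁻¹ :
      (LaurentSeries A)ˣ) * lderiv (Units.map (HahnSeries.ofPowerSeries ℤ A).toMonoidHom w :
      LaurentSeries A)).coeff (-1) = 0 := by
    refine mul_mem_orderGE (M := 0) (N := 0) ?_ (lderiv_mem_orderGE ?_) (-1) (by norm_num)
    · exact ofPowerSeries_mem_orderGE ((w⁻¹ : (PowerSeries A)ˣ) : PowerSeries A)
    · exact ofPowerSeries_mem_orderGE (w : PowerSeries A)
  rw [Units.val_mul, inv_mul_lderiv_mul, tMulUnit, Units.val_mul, inv_mul_lderiv_mul,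
    Units.val_mul, inv_mul_lderiv_mul, hu, mul_zero, add_zero, HahnSeries.coeff_add,
    HahnSeries.coeff_add, ht, hw, coeff_inv_mul_lderiv_one_add f hf v hv, add_zero, add_zero]

end Units

section Endomorphism

variable {A : Type*} [CommRing A]

/-- `res(f · g^{-l-1} dg)`. -/
noncomputable def resPairing (G : (LaurentSeries A)ˣ) (f : LaurentSeries A) (l : ℤ) : A :=
  (f * ((G ^ (-l - 1) : (LaurentSeries A)ˣ) : LaurentSeries A) *
    lderiv (G : LaurentSeries A)).coeff (-1)

theorem resPairing_add (G : (LaurentSeries A)ˣ) (x y : LaurentSeries A) (l : ℤ) :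
    resPairing G (x + y) l = resPairing G x l + resPairing G y l := by
  simp only [resPairing, add_mul, HahnSeries.coeff_add]

theorem resPairing_neg (G : (LaurentSeries A)ˣ) (x : LaurentSeries A) (l : ℤ) :
    resPairing G (-x) l = -resPairing G x l := by
  simp only [resPairing, neg_mul, HahnSeries.coeff_neg]

theorem resPairing_C_mul (G : (LaurentSeries A)ˣ) (c : A) (x : LaurentSeries A) (l : ℤ) :
    resPairing G (HahnSeries.C c * x) l = c * resPairing G x l := by
  simp only [resPairing, mul_assoc]
  rw [HahnSeries.C_mul_eq_smul, HahnSeries.coeff_smul, smul_eq_mul]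

theorem exists_forall_map_mem_orderGE (φ : LaurentSeries A →+* LaurentSeries A)
    (hcont : ∀ s : ℕ → LaurentSeries A, LSTendsToZero s → LSTendsToZero (fun i => φ (s i)))
    (N : ℤ) : ∃ K, ∀ x ∈ orderGE A K, φ x ∈ orderGE A N := by
  by_contra! h
  choose s hs hs' using fun i : ℕ => h i
  obtain ⟨I, hI⟩ := hcont s (fun M => ⟨M.toNat, fun i hi l hl => hs i l (by omega)⟩) N
  exact hs' I (hI I le_rfl)

variable (φ : LaurentSeries A →+* LaurentSeries A) (G : (LaurentSeries A)ˣ)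

theorem map_single_one_eq_zpow (hφt : φ (HahnSeries.single (1 : ℤ) 1) = G) (n : ℤ) :
    φ (HahnSeries.single n 1) = ((G ^ n : (LaurentSeries A)ˣ) : LaurentSeries A) := by
  have h : Units.map φ.toMonoidHom (tUnit A) = G := Units.ext hφt
  rw [← h, ← map_zpow, ← tUnit_zpow]
  rfl

theorem exists_map_orderGE_bounded
    (hK : ∀ N, ∃ K, ∀ x ∈ orderGE A K, φ x ∈ orderGE A N) (M : ℤ) :
    ∃ B, ∀ x ∈ orderGE A M, φ x ∈ orderGE A B := by
  obtain ⟨K, hK0⟩ := hK 0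
  obtain ⟨B, hB⟩ := exists_mem_orderGE (φ (HahnSeries.single (M - K) 1))
  refine ⟨B, fun x hx => ?_⟩
  have h1 : HahnSeries.single (K - M) (1 : A) * x ∈ orderGE A K := by
    simpa using mul_mem_orderGE (single_mem_orderGE (K - M) (1 : A)) hx
  have h2 : x = HahnSeries.single (M - K) (1 : A) * (HahnSeries.single (K - M) (1 : A) * x) := by
    rw [← mul_assoc, HahnSeries.single_mul_single]
    simp
  rw [h2, map_mul]
  simpa using mul_mem_orderGE hB (hK0 _ h1)

theorem exists_resPairing_eq_zero
    (hK : ∀ N, ∃ K, ∀ x ∈ orderGE A K, φ x ∈ orderGE A N)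
    (hφt : φ (HahnSeries.single (1 : ℤ) 1) = G) (L : ℤ) :
    ∃ N, ∀ e ∈ orderGE A N, ∀ l < L, resPairing G e l = 0 := by
  obtain ⟨B, hB⟩ := exists_map_orderGE_bounded φ hK (-L)
  obtain ⟨D, hD⟩ := exists_mem_orderGE (lderiv (G : LaurentSeries A))
  refine ⟨-B - D, fun e he l hl => ?_⟩
  have h1 := hB _ (orderGE_anti (by omega) (single_mem_orderGE (-l - 1) (1 : A)))
  rw [map_single_one_eq_zpow φ G hφt] at h1
  exact mul_mem_orderGE (mul_mem_orderGE he h1) hD (-1) (by omega)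

theorem bddBelow_support_resPairing
    (hK : ∀ N, ∃ K, ∀ x ∈ orderGE A K, φ x ∈ orderGE A N)
    (hφt : φ (HahnSeries.single (1 : ℤ) 1) = G) (f : LaurentSeries A) :
    BddBelow (Function.support (resPairing G f)) := by
  obtain ⟨M, hM⟩ := exists_mem_orderGE f
  obtain ⟨D, hD⟩ := exists_mem_orderGE (lderiv (G : LaurentSeries A))
  obtain ⟨K, hK'⟩ := hK (-M - D)
  refine ⟨-K, fun l hl => ?_⟩
  by_contra! h
  refine hl ?_
  have h1 := hK' _ (orderGE_anti (by omega) (single_mem_orderGE (-l - 1) (1 : A)))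
  rw [map_single_one_eq_zpow φ G hφt] at h1
  exact mul_mem_orderGE (mul_mem_orderGE hM h1) hD (-1) (by omega)

/-- The residue formula recovers the coefficients of `x` from `φ x`. -/
theorem resPairing_map
    (hK : ∀ N, ∃ K, ∀ x ∈ orderGE A K, φ x ∈ orderGE A N)
    (hφt : φ (HahnSeries.single (1 : ℤ) 1) = G)
    (hφC : ∀ c : A, φ (HahnSeries.C c) = HahnSeries.C c)
    (hres : (((G⁻¹ : (LaurentSeries A)ˣ) : LaurentSeries A) *
      lderiv (G : LaurentSeries A)).coeff (-1) = 1)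
    (x : LaurentSeries A) (l : ℤ) : resPairing G (φ x) l = x.coeff l := by
  let P : AddSubgroup (LaurentSeries A) :=
    { carrier := {x | resPairing G (φ x) l = x.coeff l}
      zero_mem' := by simp [resPairing]
      add_mem' := fun {x y} (hx : _ = _) (hy : _ = _) => by
        change resPairing G (φ (x + y)) l = (x + y).coeff l
        rw [map_add, resPairing_add, hx, hy, HahnSeries.coeff_add]
      neg_mem' := fun {x} (hx : _ = _) => by
        change resPairing G (φ (-x)) l = (-x).coeff l
        rw [map_neg, resPairing_neg, hx, HahnSeries.coeff_neg] }
  obtain ⟨N, hN⟩ := exists_resPairing_eq_zero φ G hK hφt (l + 1)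
  obtain ⟨K, hKN⟩ := hK N
  refine mem_of_orderGE_le P ?_ (N := max K (l + 1)) ?_ (fun j => HahnSeries.single j 1) ?_
    (fun j => single_mem_orderGE j 1) (fun j => by simp) x
  · intro c x (hx : _ = _)
    change resPairing G (φ (HahnSeries.C c * x)) l = (HahnSeries.C c * x).coeff l
    rw [map_mul, hφC, resPairing_C_mul, hx, HahnSeries.C_mul_eq_smul, HahnSeries.coeff_smul,
      smul_eq_mul]
  · intro x hx
    change resPairing G (φ x) l = x.coeff l
    rw [hN _ (hKN x (orderGE_anti (le_max_left _ _) hx)) l (by omega),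
      hx l (by have := le_max_right K (l + 1); omega)]
  · intro j
    change resPairing G (φ (HahnSeries.single j 1)) l = (HahnSeries.single j (1 : A)).coeff l
    rw [map_single_one_eq_zpow φ G hφt, resPairing, ← Units.val_mul, ← zpow_add]
    rcases eq_or_ne j l with rfl | h
    · rw [HahnSeries.coeff_single_same, show j + (-j - 1) = -1 by ring, zpow_neg_one, hres]
    · rw [HahnSeries.coeff_single_of_ne h.symm, coeff_zpow_mul_lderiv G (by omega)]

/-- The image of `φ` is dense. -/
theorem exists_sub_map_mem_orderGE
    (hφt : φ (HahnSeries.single (1 : ℤ) 1) = G)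
    (hφC : ∀ c : A, φ (HahnSeries.C c) = HahnSeries.C c)
    (u : Aˣ) (w : (PowerSeries A)ˣ) (v : (LaurentSeries A)ˣ) (hG : G = tMulUnit u w * v)
    {I : Ideal A} (hI : IsNilpotent I)
    (hv : (v : LaurentSeries A) - 1 ∈ I.map (HahnSeries.C : A →+* LaurentSeries A))
    (f : LaurentSeries A) (N : ℤ) : ∃ x, f - φ x ∈ orderGE A N := by
  set J := I.map (HahnSeries.C : A →+* LaurentSeries A) with hJ
  let U : AddSubgroup (LaurentSeries A) := φ.toAddMonoidHom.range ⊔ orderGE A N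
  have hUC : ∀ (c : A), ∀ x ∈ U, HahnSeries.C c * x ∈ U := by
    intro c x hx
    obtain ⟨_, ⟨y, rfl⟩, z, hz, rfl⟩ := AddSubgroup.mem_sup.mp hx
    refine AddSubgroup.mem_sup.mpr ⟨_, ⟨HahnSeries.C c * y, rfl⟩, HahnSeries.C c * z, ?_, ?_⟩
    · simpa using mul_mem_orderGE (C_mem_orderGE c) hz
    · change φ (HahnSeries.C c * y) + _ = HahnSeries.C c * (φ y + z)
      rw [map_mul, hφC, mul_add]
  have hmem : ∀ x, ∃ y ∈ U, x - y ∈ J := by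
    intro x
    have hx : x ∈ U ⊔ J.toAddSubgroup := by
      refine mem_of_orderGE_le _ ?_ (N := N) (le_sup_right.trans le_sup_left)
        (fun j => ((tMulUnit u w ^ j : (LaurentSeries A)ˣ) : LaurentSeries A)) ?_
        (tMulUnit_zpow_mem_orderGE u w) (isUnit_coeff_tMulUnit_zpow u w) x
      · intro c x hx
        obtain ⟨y, hy, z, hz, rfl⟩ := AddSubgroup.mem_sup.mp hx
        rw [mul_add]
        exact AddSubgroup.mem_sup.mpr ⟨_, hUC c y hy, _, J.mul_mem_left _ hz, rfl⟩
      · intro j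
        refine AddSubgroup.mem_sup.mpr ⟨((G ^ j : (LaurentSeries A)ˣ) : LaurentSeries A),
          AddSubgroup.mem_sup_left ⟨HahnSeries.single j 1, map_single_one_eq_zpow φ G hφt j⟩,
          ((tMulUnit u w ^ j : (LaurentSeries A)ˣ) : LaurentSeries A) -
            ((G ^ j : (LaurentSeries A)ˣ) : LaurentSeries A), ?_, add_sub_cancel _ _⟩
        have hv1 : Units.map (Ideal.Quotient.mk J).toMonoidHom v = 1 :=
          Units.ext (Ideal.Quotient.eq.mpr hv)
        have hGj : Units.map (Ideal.Quotient.mk J).toMonoidHom (tMulUnit u w ^ j) =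
            Units.map (Ideal.Quotient.mk J).toMonoidHom (G ^ j) := by
          rw [hG, map_zpow, map_zpow, map_mul, hv1, mul_one]
        exact Ideal.Quotient.eq.mp (congrArg Units.val hGj)
    obtain ⟨y, hy, z, hz, rfl⟩ := AddSubgroup.mem_sup.mp hx
    exact ⟨y, hy, by rwa [add_sub_cancel_left]⟩
  obtain ⟨_, ⟨x, rfl⟩, z, hz, hf⟩ :=
    AddSubgroup.mem_sup.mp (mem_of_isNilpotent_of_forall_exists U hUC hI hmem f)
  exact ⟨x, by rw [← hf]; change φ x + z - φ x ∈ _; rwa [add_sub_cancel_left]⟩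

/-- If the residue formula is a left inverse of `φ` and the image of `φ` is dense, then `φ` is
surjective. -/
theorem surjective_of_dense
    (hK : ∀ N, ∃ K, ∀ x ∈ orderGE A K, φ x ∈ orderGE A N)
    (hφt : φ (HahnSeries.single (1 : ℤ) 1) = G)
    (hleft : ∀ x l, resPairing G (φ x) l = x.coeff l)
    (hdense : ∀ f N, ∃ x, f - φ x ∈ orderGE A N) : Function.Surjective φ := by
  intro f
  let y : LaurentSeries A := HahnSeries.ofSuppBddBelow (resPairing G f)
    (bddBelow_support_resPairing φ G hK hφt f)
  have hy : ∀ l, y.coeff l = resPairing G f l := fun l => rfl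
  refine ⟨y, ?_⟩
  have hmem : ∀ N, φ y - f ∈ orderGE A N := by
    intro N
    obtain ⟨L, hL⟩ := hK N
    obtain ⟨M, hM⟩ := exists_resPairing_eq_zero φ G hK hφt L
    obtain ⟨x, hx⟩ := hdense f (max M N)
    have hyx : y - x ∈ orderGE A L := by
      intro l hl
      rw [HahnSeries.coeff_sub, hy, ← hleft x l, sub_eq_add_neg, ← resPairing_neg,
        ← resPairing_add, ← sub_eq_add_neg]
      exact hM _ (orderGE_anti (le_max_left M N) hx) l hl
    have h := (orderGE A N).sub_mem (hL _ hyx) (orderGE_anti (le_max_right M N) hx)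
    rwa [map_sub, sub_sub_sub_cancel_right] at h
  rw [← sub_eq_zero]
  ext l
  exact hmem (l + 1) l (by omega)

end Endomorphism

/-- let `φ : A((t)) → A((t))` be a continuous `A`-algebra endomorphism with
`φ(t) = g` a unit of the form `g = t·u·(1+g₊)·(1+g₋)` with `u ∈ A*`, `g₊ ∈ tA[[t]]` and `g₋`
nilpotent supported in negative degrees (so `ν(g) = 1`). Then `φ` is an automorphism and its
inverse `ψ` satisfies: the coefficient of `t^l` in `ψ(f)` equals
`res(f·g^{−l−1}·g' dt)`. -/
theorem stmt15 (A : Type*) [CommRing A] (u : Aˣ) (a : PowerSeries A) (gm : LaurentSeries A)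
    (hgmnil : IsNilpotent gm) (hgmneg : ∀ l : ℤ, 0 ≤ l → gm.coeff l = 0)
    (g : LaurentSeries A)
    (hg : g = HahnSeries.single (1 : ℤ) 1 * HahnSeries.C (u : A) *
      HahnSeries.ofPowerSeries ℤ A (1 + PowerSeries.X * a) * (1 + gm))
    (G : (LaurentSeries A)ˣ) (hG : (G : LaurentSeries A) = g)
    (φ : LaurentSeries A →ₐ[A] LaurentSeries A)
    (hcont : ∀ s : ℕ → LaurentSeries A, LSTendsToZero s → LSTendsToZero (fun i => φ (s i)))
    (hφt : φ (HahnSeries.single (1 : ℤ) 1) = g) :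
    Function.Bijective φ ∧
    ∀ ψ : LaurentSeries A →ₐ[A] LaurentSeries A,
      (∀ x, ψ (φ x) = x) → (∀ x, φ (ψ x) = x) →
      ∀ (f : LaurentSeries A) (l : ℤ),
        (ψ f).coeff l =
          (f * ((G ^ (-l - 1) : (LaurentSeries A)ˣ) : LaurentSeries A) * lderiv g).coeff (-1) := by
  obtain ⟨w, hw⟩ : IsUnit (1 + PowerSeries.X * a) := by
    rw [PowerSeries.isUnit_iff_constantCoeff]
    simp
  obtain ⟨v, hv⟩ : IsUnit (1 + gm) := hgmnil.isUnit_one_add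
  obtain ⟨I, hI, hgmI⟩ := exists_isNilpotent_ideal hgmnil hgmneg
  have hGv : G = tMulUnit u w * v := by
    refine Units.ext ?_
    rw [hG, hg, ← hw, ← hv]
    rfl
  have hφC : ∀ c : A, φ.toRingHom (HahnSeries.C c) = HahnSeries.C c := by
    intro c
    have hc : algebraMap A (LaurentSeries A) c = HahnSeries.C c := by
      rw [HahnSeries.algebraMap_apply']
      exact HahnSeries.ofPowerSeries_C c
    rw [← hc]
    exact φ.commutes c
  have hφG : φ.toRingHom (HahnSeries.single (1 : ℤ) 1) = G := hφt.trans hG.symm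
  have hK := exists_forall_map_mem_orderGE φ.toRingHom hcont
  have hleft := resPairing_map φ.toRingHom G hK hφG hφC
    (by rw [hGv]; exact coeff_inv_mul_lderiv u w gm hgmnil v hv)
  refine ⟨⟨fun x y hxy => ?_, ?_⟩, fun ψ _ hψ f l => ?_⟩
  · ext l
    rw [← hleft x l, ← hleft y l]
    exact congrArg (resPairing G · l) hxy
  · refine surjective_of_dense φ.toRingHom G hK hφG hleft fun f N => ?_
    refine exists_sub_map_mem_orderGE φ.toRingHom G hφG hφC u w v hGv hI ?_ f N
    rwa [hv, add_sub_cancel_left]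
  · rw [← hleft (ψ f) l, resPairing, hG]
    change (φ (ψ f) * _ * _).coeff (-1) = _
    rw [hψ]
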